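/- Let Q₁ and Q₂ be full conjunctive queries with negation (full CQ¬, without inequalities) over the same schema and with the same head relation, and assume Q₁ is satisfiable, i.e., pos(Q₁) ∩ neg(Q₁) = ∅. Then Q₁ ⊆ Q₂ if and only if there is a substitution h from the variables of Q₂ to the variables of Q₁ such that h(head(Q₂)) = head(Q₁), h(pos(Q₂)) ⊆ pos(Q₁), and h(neg(Q₂)) ⊆ neg(Q₁). -/

import Mathlib

/-- An atom `R(x₁,…,x_k)`: a relation name together with a tuple of variables. -/
structure Atom (R V : Type) where
  rel : R
  args : List V
deriving DecidableEq

/-- A fact `R(t)`: a relation name together with a tuple of data values. -/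
structure DBFact (R D : Type) where
  rel : R
  args : List D
deriving DecidableEq

/-- Applying a valuation to an atom yields a fact. -/
def Atom.app {R V D : Type} (f : V → D) (a : Atom R V) : DBFact R D :=
  ⟨a.rel, a.args.map f⟩

/-- The variables occurring in an atom. -/
def Atom.vars {R V : Type} (a : Atom R V) : Set V := {v | v ∈ a.args}

/-- A conjunctive query with negation and inequalities (CQ¬,≠): a head atom,
finite sets of positive and negated body atoms, and a finite set of
inequalities between variables. -/
structure CQ (R V : Type) where
  head : Atom R V
  pos : Finset (Atom R V)
  neg : Finset (Atom R V)
  ineq : Finset (V × V)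

namespace CQ

variable {R V D : Type}

/-- The variables occurring in a query. -/
def vars (Q : CQ R V) : Set V :=
  Q.head.vars ∪ (⋃ a ∈ (↑Q.pos : Set (Atom R V)), a.vars) ∪
    (⋃ a ∈ (↑Q.neg : Set (Atom R V)), a.vars) ∪
    (⋃ p ∈ (↑Q.ineq : Set (V × V)), {p.1, p.2})

/-- Safety: every head variable and every variable of a negated atom occurs in
some positive atom. -/
def safe (Q : CQ R V) : Prop :=
  (∀ v ∈ Q.head.vars, ∃ a ∈ Q.pos, v ∈ a.args) ∧
  (∀ a ∈ Q.neg, ∀ v ∈ a.args, ∃ b ∈ Q.pos, v ∈ b.args)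

/-- A query is full if every one of its variables occurs in its head atom. -/
def isFull (Q : CQ R V) : Prop := ∀ v ∈ Q.vars, v ∈ Q.head.args

/-- The facts required by a valuation `f`: `f(pos(Q))`. -/
def posFacts (Q : CQ R V) (f : V → D) : Set (DBFact R D) :=
  Atom.app f '' (↑Q.pos : Set (Atom R V))

/-- The facts prohibited by a valuation `f`: `f(neg(Q))`. -/
def negFacts (Q : CQ R V) (f : V → D) : Set (DBFact R D) :=
  Atom.app f '' (↑Q.neg : Set (Atom R V))

/-- `f` is a valuation for `Q`: required and prohibited facts are disjoint and
all inequalities are respected. -/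
def isVal (Q : CQ R V) (f : V → D) : Prop :=
  Q.posFacts f ∩ Q.negFacts f = ∅ ∧
  ∀ p ∈ Q.ineq, f p.1 ≠ f p.2

/-- `f` satisfies `Q` on `I`: all required facts are in `I` and no prohibited
fact is in `I`. -/
def sat (Q : CQ R V) (f : V → D) (I : Set (DBFact R D)) : Prop :=
  Q.posFacts f ⊆ I ∧ Q.negFacts f ∩ I = ∅

/-- `Q(I)`: the set of facts derived on `I` by valuations satisfying `Q`. -/
def eval (Q : CQ R V) (I : Set (DBFact R D)) : Set (DBFact R D) :=
  {fc | ∃ f : V → D, Q.isVal f ∧ Q.sat f I ∧ Atom.app f Q.head = fc}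

end CQ

/-- A union of conjunctive queries (with negation and inequalities): a finite,
nonempty family of CQ¬,≠s. -/
structure UCQ (R V : Type) where
  n : ℕ
  npos : 0 < n
  disj : Fin n → CQ R V

namespace UCQ

variable {R V D : Type}

/-- Well-formedness of a UCQ: every disjunct is safe, all disjuncts have the
same head relation, and distinct disjuncts have disjoint variable sets. -/
def wf (Q : UCQ R V) : Prop :=
  (∀ i, (Q.disj i).safe) ∧
  (∀ i j, (Q.disj i).head.rel = (Q.disj j).head.rel) ∧
  (∀ i j, i ≠ j → Disjoint (Q.disj i).vars (Q.disj j).vars)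

/-- `Q(I) = ⋃ᵢ Qᵢ(I)`. -/
def eval (Q : UCQ R V) (I : Set (DBFact R D)) : Set (DBFact R D) :=
  ⋃ i, (Q.disj i).eval I

/-- The maximum number of variables of any disjunct. -/
noncomputable def varmax (Q : UCQ R V) : ℕ :=
  Finset.univ.sup fun i => ((Q.disj i).vars).ncard

end UCQ

/-- The values of the fact all belong to `U`. -/
def DBFact.valsIn {R D : Type} (fc : DBFact R D) (U : Set D) : Prop :=
  ∀ d ∈ fc.args, d ∈ U

/-- The active domain of an instance: all data values occurring in it. -/
def adom {R D : Type} (I : Set (DBFact R D)) : Set D :=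
  {d | ∃ fc ∈ I, d ∈ fc.args}

/-- Applying a substitution (a map on variables) to an atom. -/
def Atom.subst {R V W : Type} (h : V → W) (a : Atom R V) : Atom R W :=
  ⟨a.rel, a.args.map h⟩

theorem List.eq_of_map_eq_of_injOn {α β : Type*} {f : α → β} {S : Set α} (hf : S.InjOn f) :
    ∀ {l m : List α}, (∀ x ∈ l, x ∈ S) → (∀ x ∈ m, x ∈ S) → l.map f = m.map f → l = m
  | [], [], _, _, _ => rfl
  | [], _ :: _, _, _, h => by simp at h
  | _ :: _, [], _, _, h => by simp at h
  | x :: l, y :: m, hl, hm, h => by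
    simp only [List.map_cons, List.cons.injEq] at h
    simp only [List.mem_cons, forall_eq_or_imp] at hl hm
    rw [hf hl.1 hm.1 h.1, List.eq_of_map_eq_of_injOn hf hl.2 hm.2 h.2]

theorem List.exists_injOn_mem {α : Type*} (β : Type*) [Infinite β] (l : List α) :
    ∃ f : α → β, {x | x ∈ l}.InjOn f := by
  classical
  refine ⟨fun x => Infinite.natEmbedding β (l.idxOf x), fun x hx y _ h => ?_⟩
  exact (List.idxOf_inj hx).1 ((Infinite.natEmbedding β).injective h)

theorem Atom.app_subst {R V W D : Type} (f : W → D) (h : V → W) (a : Atom R V) :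
    Atom.app f (Atom.subst h a) = Atom.app (f ∘ h) a := by
  simp [Atom.app, Atom.subst]

theorem Atom.app_congr {R V D : Type} {f g : V → D} {a : Atom R V}
    (h : ∀ v ∈ a.args, f v = g v) : Atom.app f a = Atom.app g a := by
  simpa [Atom.app] using h

theorem Atom.eq_of_app_eq {R V D : Type} {f : V → D} {S : Set V} (hf : S.InjOn f)
    {a b : Atom R V} (ha : ∀ v ∈ a.args, v ∈ S) (hb : ∀ v ∈ b.args, v ∈ S)
    (h : Atom.app f a = Atom.app f b) : a = b := by
  obtain ⟨r, l⟩ := a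
  obtain ⟨s, m⟩ := b
  simp only [Atom.app, DBFact.mk.injEq] at h
  exact congrArg₂ Atom.mk h.1 (List.eq_of_map_eq_of_injOn hf ha hb h.2)

namespace CQ

variable {R V D : Type}

theorem isFull.mem_head_of_pos {Q : CQ R V} (hQ : Q.isFull) {a : Atom R V} (ha : a ∈ Q.pos)
    {v : V} (hv : v ∈ a.args) : v ∈ Q.head.args :=
  hQ v (Or.inl (Or.inl (Or.inr (Set.mem_biUnion (Finset.mem_coe.2 ha) hv))))

theorem isFull.mem_head_of_neg {Q : CQ R V} (hQ : Q.isFull) {a : Atom R V} (ha : a ∈ Q.neg)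
    {v : V} (hv : v ∈ a.args) : v ∈ Q.head.args :=
  hQ v (Or.inl (Or.inr (Set.mem_biUnion (Finset.mem_coe.2 ha) hv)))

theorem eval_subset_eval_of_subst {Q1 Q2 : CQ R V} (hi2 : Q2.ineq = ∅) {h : V → V}
    (hhead : Atom.subst h Q2.head = Q1.head) (hpos : ∀ a ∈ Q2.pos, Atom.subst h a ∈ Q1.pos)
    (hneg : ∀ a ∈ Q2.neg, Atom.subst h a ∈ Q1.neg) (I : Set (DBFact R D)) :
    Q1.eval I ⊆ Q2.eval I := by
  rintro _ ⟨f, ⟨hval, -⟩, ⟨hfpos, hfneg⟩, rfl⟩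
  have hp : Q2.posFacts (f ∘ h) ⊆ Q1.posFacts f := by
    rintro _ ⟨a, ha, rfl⟩
    exact ⟨_, hpos a ha, Atom.app_subst f h a⟩
  have hn : Q2.negFacts (f ∘ h) ⊆ Q1.negFacts f := by
    rintro _ ⟨a, ha, rfl⟩
    exact ⟨_, hneg a ha, Atom.app_subst f h a⟩
  refine ⟨f ∘ h, ⟨?_, by simp [hi2]⟩, ⟨hp.trans hfpos, ?_⟩, ?_⟩
  · exact Set.subset_eq_empty (Set.inter_subset_inter hp hn) hval
  · exact Set.subset_eq_empty (Set.inter_subset_inter_left I hn) hfneg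
  · rw [← hhead, Atom.app_subst]

theorem posFacts_inter_negFacts_of_injOn {Q : CQ R V} (hQ : Q.isFull)
    (hsat : ∀ a ∈ Q.pos, a ∉ Q.neg) {f : V → D} (hf : {v | v ∈ Q.head.args}.InjOn f) :
    Q.posFacts f ∩ Q.negFacts f = ∅ := by
  rw [Set.eq_empty_iff_forall_notMem]
  rintro _ ⟨⟨a, ha, rfl⟩, ⟨b, hb, hab⟩⟩
  have : b = a := Atom.eq_of_app_eq hf (fun _ => hQ.mem_head_of_neg hb)
    (fun _ => hQ.mem_head_of_pos ha) hab
  exact hsat a ha (this ▸ hb)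

theorem exists_subst_of_eval_subset [Infinite D] {Q1 Q2 : CQ R V} (hi1 : Q1.ineq = ∅)
    (hf1 : Q1.isFull) (hf2 : Q2.isFull) (hsat : ∀ a ∈ Q1.pos, a ∉ Q1.neg)
    (hsub : ∀ I : Set (DBFact R D), I.Finite → Q1.eval I ⊆ Q2.eval I) :
    ∃ h : V → V, Atom.subst h Q2.head = Q1.head ∧
      (∀ a ∈ Q2.pos, Atom.subst h a ∈ Q1.pos) ∧ (∀ a ∈ Q2.neg, Atom.subst h a ∈ Q1.neg) := by
  obtain ⟨f, hf⟩ := List.exists_injOn_mem D Q1.head.args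
  have hdisj := posFacts_inter_negFacts_of_injOn hf1 hsat hf
  have hval : Q1.isVal f := ⟨hdisj, by simp [hi1]⟩
  have hfin : (Q1.posFacts f).Finite := Q1.pos.finite_toSet.image _
  obtain ⟨g, -, ⟨hgpos, -⟩, hghead⟩ := hsub _ hfin ⟨f, hval, ⟨subset_rfl, by
    rw [Set.inter_comm, hdisj]⟩, rfl⟩
  have hargs : Q2.head.args.map g = Q1.head.args.map f := congrArg DBFact.args hghead
  have hex : ∀ v, ∃ w, v ∈ Q2.head.args → w ∈ Q1.head.args ∧ f w = g v := by
    intro v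
    by_cases hv : v ∈ Q2.head.args
    · have : g v ∈ Q1.head.args.map f := hargs ▸ List.mem_map_of_mem hv
      obtain ⟨w, hw⟩ := List.mem_map.1 this
      exact ⟨w, fun _ => hw⟩
    · exact ⟨v, fun h => absurd h hv⟩
  choose h hh using hex
  have hlift : ∀ a b : Atom R V, (∀ v ∈ a.args, v ∈ Q2.head.args) →
      (∀ v ∈ b.args, v ∈ Q1.head.args) → Atom.app g a = Atom.app f b →
      Atom.subst h a = b := by
    intro a b ha hb hab
    refine Atom.eq_of_app_eq hf ?_ hb ?_
    · intro v hv
      obtain ⟨w, hw, rfl⟩ := List.mem_map.1 hv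
      exact (hh w (ha w hw)).1
    · rw [Atom.app_subst, ← hab]
      exact Atom.app_congr fun v hv => (hh v (ha v hv)).2
  refine ⟨h, hlift _ _ (fun _ => id) (fun _ => id) hghead, fun a ha => ?_, fun a ha => ?_⟩
  · obtain ⟨b, hb, hba⟩ := hgpos ⟨a, ha, rfl⟩
    rw [hlift a b (fun _ => hf2.mem_head_of_pos ha) (fun _ => hf1.mem_head_of_pos hb) hba.symm]
    exact hb
  · by_cases hmem : Atom.app g a ∈ Q1.negFacts f
    · obtain ⟨b, hb, hba⟩ := hmem
      rw [hlift a b (fun _ => hf2.mem_head_of_neg ha) (fun _ => hf1.mem_head_of_neg hb) hba.symm]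
      exact hb
    · obtain ⟨g', -, ⟨-, hgneg⟩, hghead'⟩ := hsub _ (hfin.insert (Atom.app g a))
        ⟨f, hval, ⟨Set.subset_insert _ _, by
          rw [Set.inter_insert_of_notMem hmem, Set.inter_comm, hdisj]⟩, rfl⟩
      have hgg : ∀ v ∈ Q2.head.args, g' v = g v := by
        simpa [Atom.app] using hghead'.trans hghead.symm
      have hag : Atom.app g' a = Atom.app g a :=
        Atom.app_congr fun v hv => hgg v (hf2.mem_head_of_neg ha hv)
      exact (Set.eq_empty_iff_forall_notMem.1 hgneg _
        ⟨⟨a, ha, hag⟩, Set.mem_insert _ _⟩).elim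

end CQ

/-- For full CQ¬s `Q₁, Q₂` over the same schema with the same
head relation, with `Q₁` satisfiable (`pos(Q₁) ∩ neg(Q₁) = ∅`):
`Q₁ ⊆ Q₂` iff there is a substitution `h` with `h(head(Q₂)) = head(Q₁)`,
`h(pos(Q₂)) ⊆ pos(Q₁)` and `h(neg(Q₂)) ⊆ neg(Q₁)`. -/
theorem full_cqneg_containment_iff_substitution {R V D : Type} [Infinite D]
    (Q1 Q2 : CQ R V)
    (hs1 : Q1.safe) (hs2 : Q2.safe)
    (hi1 : Q1.ineq = ∅) (hi2 : Q2.ineq = ∅)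
    (hf1 : Q1.isFull) (hf2 : Q2.isFull)
    (hhead : Q1.head.rel = Q2.head.rel)
    (hsat : ∀ a ∈ Q1.pos, a ∉ Q1.neg) :
    (∀ I : Set (DBFact R D), I.Finite → Q1.eval I ⊆ Q2.eval I) ↔
      ∃ h : V → V, Atom.subst h Q2.head = Q1.head ∧
        (∀ a ∈ Q2.pos, Atom.subst h a ∈ Q1.pos) ∧
        (∀ a ∈ Q2.neg, Atom.subst h a ∈ Q1.neg) := by
  constructor
  · exact CQ.exists_subst_of_eval_subset hi1 hf1 hf2 hsat
  · rintro ⟨h, hhd, hpos, hneg⟩ I -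
    exact CQ.eval_subset_eval_of_subst hi2 hhd hpos hneg I
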